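/- arXiv:1901.05374 — 8 statements merged into one kernel-verified Lean document; each statement's English description precedes it below -/
import Mathlib

section
/- For every n ≥ 1, every δ ∈ ℝ and every v ∈ {−1,1}ⁿ, the smallest eigenvalue of the Hermitian matrix H_v^δ is −n. Explicitly: ⟨ψ, H_v^δ ψ⟩ ≥ −n for every unit vector ψ ∈ ℂ^{2ⁿ}, and the vector ψ_v^δ defined by ψ_v^δ(f) = ∏_{i=1}^n c_i(f i), where c_i(0) = cos(π/8 + v_i δ/2) and c_i(1) = sin(π/8 + v_i δ/2), is a unit vector satisfying H_v^δ ψ_v^δ = −n · ψ_v^δ. -/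
open Matrix Real Finset

/-- Single-site Pauli X on qubit `i` of an `n`-qubit system. -/
noncomputable def pauliX (n : ℕ) (i : Fin n) : Matrix (Fin n → Fin 2) (Fin n → Fin 2) ℂ :=
  fun f g => if f i ≠ g i ∧ ∀ j, j ≠ i → f j = g j then 1 else 0

/-- Single-site Pauli Z on qubit `i` of an `n`-qubit system. -/
noncomputable def pauliZ (n : ℕ) (i : Fin n) : Matrix (Fin n → Fin 2) (Fin n → Fin 2) ℂ :=
  fun f g => if f = g then (-1 : ℂ) ^ ((f i : ℕ)) else 0

/-- The objective observable `H_v^δ = -∑ᵢ [sin(π/4 + vᵢ δ) Xᵢ + cos(π/4 + vᵢ δ) Zᵢ]`. -/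
noncomputable def Ham (n : ℕ) (δ : ℝ) (v : Fin n → ℝ) :
    Matrix (Fin n → Fin 2) (Fin n → Fin 2) ℂ :=
  - ∑ i : Fin n, (((Real.sin (π/4 + v i * δ) : ℝ) : ℂ) • pauliX n i
      + ((Real.cos (π/4 + v i * δ) : ℝ) : ℂ) • pauliZ n i)

/-- The quadratic form `⟨ψ, M ψ⟩`, conjugate-linear in the first argument. -/
noncomputable def qform {m : Type*} [Fintype m] (M : Matrix m m ℂ) (ψ : m → ℂ) : ℂ :=
  star ψ ⬝ᵥ M.mulVec ψ

/-- The product ground state `ψ_v^δ` with coefficients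
`ψ_v^δ(f) = ∏ᵢ cᵢ(f i)`, `cᵢ(0) = cos(π/8 + vᵢδ/2)`, `cᵢ(1) = sin(π/8 + vᵢδ/2)`. -/
noncomputable def groundState (n : ℕ) (δ : ℝ) (v : Fin n → ℝ) : (Fin n → Fin 2) → ℂ :=
  fun f => ∏ i : Fin n,
    (if f i = 0 then ((Real.cos (π/8 + v i * δ / 2) : ℝ) : ℂ)
     else ((Real.sin (π/8 + v i * δ / 2) : ℝ) : ℂ))

/-- The single-site observable `sin θ Xᵢ + cos θ Zᵢ`. -/
noncomputable def siteObs (n : ℕ) (θ : ℝ) (i : Fin n) :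
    Matrix (Fin n → Fin 2) (Fin n → Fin 2) ℂ :=
  ((Real.sin θ : ℝ) : ℂ) • pauliX n i + ((Real.cos θ : ℝ) : ℂ) • pauliZ n i

theorem ne_and_eq_off_iff_update {n : ℕ} (i : Fin n) (f g : Fin n → Fin 2) :
    (f i ≠ g i ∧ ∀ j, j ≠ i → f j = g j) ↔ g = Function.update f i (1 - f i) := by
  constructor
  · rintro ⟨h, h'⟩
    ext1 j
    by_cases hj : j = i
    · subst hj
      rw [Function.update_self]
      generalize f j = a at *
      generalize g j = b at *
      revert a b
      decide
    · rw [Function.update_of_ne hj, h' j hj]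
  · rintro rfl
    refine ⟨?_, fun j hj => by rw [Function.update_of_ne hj]⟩
    rw [Function.update_self]
    generalize f i = a
    revert a
    decide

theorem pauliX_mulVec {n : ℕ} (i : Fin n) (ψ : (Fin n → Fin 2) → ℂ) (f : Fin n → Fin 2) :
    (pauliX n i).mulVec ψ f = ψ (Function.update f i (1 - f i)) := by
  simp only [Matrix.mulVec, dotProduct, pauliX, ne_and_eq_off_iff_update]
  simp

theorem pauliZ_mulVec {n : ℕ} (i : Fin n) (ψ : (Fin n → Fin 2) → ℂ) (f : Fin n → Fin 2) :
    (pauliZ n i).mulVec ψ f = (-1) ^ (f i : ℕ) * ψ f := by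
  simp [Matrix.mulVec, dotProduct, pauliZ]

theorem siteObs_mulVec {n : ℕ} (θ : ℝ) (i : Fin n) (ψ : (Fin n → Fin 2) → ℂ)
    (f : Fin n → Fin 2) :
    (siteObs n θ i).mulVec ψ f = (Real.sin θ : ℂ) * ψ (Function.update f i (1 - f i)) +
      (Real.cos θ : ℂ) * ((-1) ^ (f i : ℕ) * ψ f) := by
  simp only [siteObs, Matrix.add_mulVec, Matrix.smul_mulVec, Pi.add_apply, Pi.smul_apply,
    pauliX_mulVec, pauliZ_mulVec, smul_eq_mul]

theorem siteObs_mulVec_mulVec {n : ℕ} (θ : ℝ) (i : Fin n) (ψ : (Fin n → Fin 2) → ℂ) :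
    (siteObs n θ i).mulVec ((siteObs n θ i).mulVec ψ) = ψ := by
  have h : ((Real.sin θ : ℝ) : ℂ) ^ 2 + ((Real.cos θ : ℝ) : ℂ) ^ 2 = 1 := by
    exact_mod_cast Real.sin_sq_add_cos_sq θ
  ext f
  have hb : ∀ b : Fin 2, (1 : Fin 2) - (1 - b) = b := by decide
  simp only [siteObs_mulVec, Function.update_self, Function.update_idem, hb,
    Function.update_eq_self]
  obtain hf | hf : f i = 0 ∨ f i = 1 := by
    generalize f i = a
    revert a
    decide
  all_goals
    simp [hf, -Complex.ofReal_sin, -Complex.ofReal_cos]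
    linear_combination ψ f * h

theorem siteObs_isHermitian {n : ℕ} (θ : ℝ) (i : Fin n) : (siteObs n θ i).IsHermitian := by
  have hX : (pauliX n i).IsHermitian := by
    ext f g
    simp only [Matrix.conjTranspose_apply, pauliX, ne_comm (a := g i), eq_comm (a := g _)]
    split_ifs <;> simp
  have hZ : (pauliZ n i).IsHermitian := by
    ext f g
    simp only [Matrix.conjTranspose_apply, pauliZ, eq_comm (a := g)]
    split_ifs with h <;> simp [h]
  rw [Matrix.IsHermitian, siteObs, Matrix.conjTranspose_add, Matrix.conjTranspose_smul,
    Matrix.conjTranspose_smul, hX.eq, hZ.eq]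
  simp [-Complex.ofReal_sin, -Complex.ofReal_cos]

/-- A Hermitian involution has quadratic form at most the squared norm. -/
theorem re_dotProduct_mulVec_le_of_involutive {m : Type*} [Fintype m] {A : Matrix m m ℂ}
    (hA : A.IsHermitian) (h : ∀ ψ, A.mulVec (A.mulVec ψ) = ψ) (ψ : m → ℂ) :
    (star ψ ⬝ᵥ A.mulVec ψ).re ≤ (star ψ ⬝ᵥ ψ).re := by
  have hs : ∀ φ, star (A.mulVec ψ) ⬝ᵥ φ = star ψ ⬝ᵥ A.mulVec φ := fun φ => by
    rw [Matrix.star_mulVec, hA.eq, Matrix.dotProduct_mulVec]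
  have hpos : 0 ≤ (star (ψ - A.mulVec ψ) ⬝ᵥ (ψ - A.mulVec ψ)).re :=
    open scoped ComplexOrder in
    (Complex.le_def.1 (dotProduct_star_self_nonneg (ψ - A.mulVec ψ))).1
  rw [star_sub, sub_dotProduct, hs, Matrix.mulVec_sub, h, dotProduct_sub, dotProduct_sub] at hpos
  simp only [Complex.sub_re] at hpos
  linarith

theorem siteObs_mulVec_groundState {n : ℕ} (δ : ℝ) (v : Fin n → ℝ) (i : Fin n) :
    (siteObs n (π / 4 + v i * δ) i).mulVec (groundState n δ v) = groundState n δ v := by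
  ext f
  have hprod (g : Fin n → Fin 2) (hg : ∀ j, j ≠ i → g j = f j) : groundState n δ v g =
      (if g i = 0 then ((Real.cos (π/8 + v i * δ / 2) : ℝ) : ℂ)
        else ((Real.sin (π/8 + v i * δ / 2) : ℝ) : ℂ)) *
      ∏ j ∈ univ.erase i, (if f j = 0 then ((Real.cos (π/8 + v j * δ / 2) : ℝ) : ℂ)
        else ((Real.sin (π/8 + v j * δ / 2) : ℝ) : ℂ)) := by
    rw [groundState, ← Finset.mul_prod_erase univ _ (Finset.mem_univ i)]
    congr 1
    refine Finset.prod_congr rfl fun j hj => ?_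
    rw [hg j (Finset.ne_of_mem_erase hj)]
  rw [siteObs_mulVec, hprod (Function.update f i (1 - f i))
    (fun j hj => Function.update_of_ne hj _ _), hprod f (fun _ _ => rfl), Function.update_self]
  generalize (∏ j ∈ univ.erase i, _ : ℂ) = P
  have hθ : π / 4 + v i * δ = 2 * (π / 8 + v i * δ / 2) := by ring
  rw [hθ]
  generalize π / 8 + v i * δ / 2 = t
  have h : ((Real.sin t : ℝ) : ℂ) ^ 2 + ((Real.cos t : ℝ) : ℂ) ^ 2 = 1 := by
    exact_mod_cast Real.sin_sq_add_cos_sq t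
  rw [Real.sin_two_mul, Real.cos_two_mul]
  obtain hf | hf : f i = 0 ∨ f i = 1 := by
    generalize f i = a
    revert a
    decide
  · simp [hf, -Complex.ofReal_sin, -Complex.ofReal_cos]
    linear_combination (2 * (Real.cos t : ℂ) * P) * h
  · simp [hf, -Complex.ofReal_sin, -Complex.ofReal_cos]
    ring

theorem star_groundState_dotProduct_self (n : ℕ) (δ : ℝ) (v : Fin n → ℝ) :
    star (groundState n δ v) ⬝ᵥ groundState n δ v = 1 := by
  have hsum := Finset.prod_univ_sum (fun _ : Fin n => (univ : Finset (Fin 2)))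
    (fun i b => (if b = 0 then ((Real.cos (π/8 + v i * δ / 2) : ℝ) : ℂ)
      else ((Real.sin (π/8 + v i * δ / 2) : ℝ) : ℂ)) ^ 2)
  rw [Fintype.piFinset_univ] at hsum
  trans ∑ f : Fin n → Fin 2, ∏ i, (if f i = 0 then ((Real.cos (π/8 + v i * δ / 2) : ℝ) : ℂ)
      else ((Real.sin (π/8 + v i * δ / 2) : ℝ) : ℂ)) ^ 2
  · refine Finset.sum_congr rfl fun f _ => ?_
    rw [Pi.star_apply, groundState, star_prod, ← Finset.prod_mul_distrib]
    refine Finset.prod_congr rfl fun i _ => ?_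
    split_ifs <;> rw [sq] <;> congr 1 <;> exact Complex.conj_ofReal _
  · rw [← hsum]
    refine Finset.prod_eq_one fun i _ => ?_
    rw [Fin.sum_univ_two, if_pos rfl, if_neg one_ne_zero]
    exact_mod_cast Real.cos_sq_add_sin_sq _

theorem Ham_mulVec (n : ℕ) (δ : ℝ) (v : Fin n → ℝ) (ψ : (Fin n → Fin 2) → ℂ) :
    (Ham n δ v).mulVec ψ = -∑ i, (siteObs n (π / 4 + v i * δ) i).mulVec ψ := by
  rw [← Matrix.sum_mulVec, ← Matrix.neg_mulVec]
  rfl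

/-- For every `n ≥ 1`, `δ ∈ ℝ` and `v ∈ {-1,1}ⁿ`, the smallest eigenvalue of `H_v^δ` is `-n`:
the quadratic form is `≥ -n` on unit vectors, and `ψ_v^δ` is a unit eigenvector with
eigenvalue `-n`. -/
theorem smallest_eigenvalue_Ham (n : ℕ) (hn : 1 ≤ n) (δ : ℝ) (v : Fin n → ℝ)
    (hv : ∀ i, v i = 1 ∨ v i = -1) :
    (∀ ψ : (Fin n → Fin 2) → ℂ, star ψ ⬝ᵥ ψ = 1 → -(n : ℝ) ≤ (qform (Ham n δ v) ψ).re) ∧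
    star (groundState n δ v) ⬝ᵥ groundState n δ v = 1 ∧
    (Ham n δ v).mulVec (groundState n δ v) = ((-(n : ℝ) : ℝ) : ℂ) • groundState n δ v := by
  refine ⟨fun ψ hψ => ?_, star_groundState_dotProduct_self n δ v, ?_⟩
  · have hle : ∑ i, (star ψ ⬝ᵥ (siteObs n (π / 4 + v i * δ) i).mulVec ψ).re ≤
        ∑ _i : Fin n, (1 : ℝ) := Finset.sum_le_sum fun i _ => by
      simpa [hψ] using re_dotProduct_mulVec_le_of_involutive (siteObs_isHermitian _ i)
        (siteObs_mulVec_mulVec (π / 4 + v i * δ) i) ψ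
    rw [qform, Ham_mulVec, dotProduct_neg, dotProduct_sum, Complex.neg_re, Complex.re_sum]
    simpa using hle
  · rw [Ham_mulVec, Finset.sum_congr rfl fun i _ => siteObs_mulVec_groundState δ v i]
    ext f
    simp
end

section
/- (Gilbert–Varshamov bound.) For every n ≥ 1 there exists a subset V of the hypercube {−1,1}ⁿ of cardinality |V| ≥ e^{n/8} such that the Hamming distance satisfies Δ(v,v′) ≥ n/4 for all distinct v, v′ ∈ V. -/
open Finset in
/-- Every finite set of words contains a maximal code of prescribed minimum distance, and by
maximality every word lies at smaller distance from some codeword. -/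
lemma exists_code_covering {ι α : Type*} [Fintype ι] [DecidableEq α] (A : Finset (ι → α)) (d : ℝ) :
    ∃ V ⊆ A, (∀ v ∈ V, ∀ v' ∈ V, v ≠ v' → d ≤ hammingDist v v') ∧
      ∀ w ∈ A, ∃ v ∈ V, v = w ∨ (hammingDist v w : ℝ) < d := by
  classical
  obtain ⟨V, hV, hmax⟩ := exists_max_image
    (A.powerset.filter fun V => ∀ v ∈ V, ∀ v' ∈ V, v ≠ v' → d ≤ hammingDist v v') card
    ⟨∅, by simp⟩
  rw [mem_filter, mem_powerset] at hV
  refine ⟨V, hV.1, hV.2, fun w hw => ?_⟩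
  by_contra! hfar
  have hwV : w ∉ V := fun h => (hfar w h).1 rfl
  have hcard := hmax (insert w V) (by
    rw [mem_filter, mem_powerset]
    refine ⟨insert_subset hw hV.1, fun v hv v' hv' hne => ?_⟩
    rcases mem_insert.1 hv with rfl | hvV <;> rcases mem_insert.1 hv' with rfl | hvV'
    · exact absurd rfl hne
    · rw [hammingDist_comm]
      exact (hfar v' hvV').2
    · exact (hfar v hvV).2
    · exact hV.2 v hvV v' hvV' hne)
  rw [card_insert_of_notMem hwV] at hcard
  omega

open Finset in
/-- The distance enumerator of the space of words over a finite alphabet. -/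
lemma sum_pow_hammingDist {ι α : Type*} [Fintype ι] [DecidableEq ι] [DecidableEq α]
    (s : Finset α) (t : ℝ) {v : ι → α} (hv : ∀ i, v i ∈ s) :
    ∑ w ∈ Fintype.piFinset (fun _ : ι => s), t ^ hammingDist v w
      = (1 + (#s - 1) * t) ^ Fintype.card ι := by
  have hprod (w : ι → α) : t ^ hammingDist v w = ∏ i, if v i = w i then 1 else t := by
    simp [hammingDist, prod_ite]
  have hsum (i : ι) : ∑ a ∈ s, (if v i = a then 1 else t) = 1 + (#s - 1) * t := by
    rw [← add_sum_erase s _ (hv i), if_pos rfl,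
      sum_congr rfl fun a ha => if_neg (ne_of_mem_erase ha).symm, sum_const, nsmul_eq_mul,
      card_erase_of_mem (hv i), Nat.cast_pred (card_pos.2 ⟨_, hv i⟩)]
  simp_rw [hprod]
  rw [← prod_univ_sum (fun _ => s) (fun i a => if v i = a then 1 else t)]
  simp [hsum]

open Finset in
/-- A covering code of radius `d` satisfies a sphere-covering bound, with the volume of a ball
replaced by its Chernoff upper bound. -/
lemma card_pow_le_card_mul_of_covering {ι α : Type*} [Fintype ι] [DecidableEq ι] [DecidableEq α]
    (s : Finset α) {t d : ℝ} (ht : 0 < t) (ht1 : t ≤ 1)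
    {V : Finset (ι → α)} (hV : V ⊆ Fintype.piFinset fun _ => s)
    (hcov : ∀ w ∈ Fintype.piFinset (fun _ : ι => s), ∃ v ∈ V, (hammingDist v w : ℝ) ≤ d) :
    t ^ d * (#s : ℝ) ^ Fintype.card ι ≤ #V * (1 + (#s - 1) * t) ^ Fintype.card ι := by
  calc t ^ d * (#s : ℝ) ^ Fintype.card ι
      = ∑ w ∈ Fintype.piFinset (fun _ : ι => s), t ^ d := by simp [mul_comm]
    _ ≤ ∑ w ∈ Fintype.piFinset (fun _ : ι => s), ∑ v ∈ V, t ^ hammingDist v w := by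
        refine sum_le_sum fun w hw => ?_
        obtain ⟨v, hv, hvw⟩ := hcov w hw
        refine le_trans ?_ (single_le_sum (f := fun v => t ^ hammingDist v w)
          (fun _ _ => by positivity) hv)
        rw [← Real.rpow_natCast]
        exact Real.rpow_le_rpow_of_exponent_ge ht ht1 hvw
    _ = ∑ v ∈ V, (1 + (#s - 1) * t) ^ Fintype.card ι := by
        rw [sum_comm]
        exact sum_congr rfl fun v hv => sum_pow_hammingDist s t (Fintype.mem_piFinset.1 (hV hv))
    _ = #V * (1 + (#s - 1) * t) ^ Fintype.card ι := by simp

lemma exp_one_eighth_le : Real.exp (1 / 8) ≤ 3 / 2 * (1 / 3 : ℝ) ^ (1 / 4 : ℝ) := by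
  refine le_of_pow_le_pow_left₀ (n := 8) (by norm_num) (by positivity) ?_
  rw [mul_pow, ← Real.exp_nat_mul, ← Real.rpow_mul_natCast (by norm_num)]
  norm_num
  linarith [Real.exp_one_lt_d9]

/-- Gilbert–Varshamov bound: for every `n ≥ 1` there is a subset `V` of the hypercube
`{-1,1}ⁿ` with `|V| ≥ e^(n/8)` whose elements are pairwise at Hamming distance `≥ n/4`. -/
theorem gilbert_varshamov (n : ℕ) (hn : 1 ≤ n) :
    ∃ V : Finset (Fin n → ℝ),
      (∀ v ∈ V, ∀ i, v i = 1 ∨ v i = -1) ∧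
      Real.exp ((n : ℝ) / 8) ≤ V.card ∧
      ∀ v ∈ V, ∀ v' ∈ V, v ≠ v' → ((n : ℝ) / 4) ≤ hammingDist v v' := by
  obtain ⟨V, hV, hdist, hcov⟩ := exists_code_covering
    (Fintype.piFinset fun _ : Fin n => ({1, -1} : Finset ℝ)) (n / 4)
  refine ⟨V, fun v hv i => by simpa using Fintype.mem_piFinset.1 (hV hv) i, ?_, hdist⟩
  have hbound := card_pow_le_card_mul_of_covering (t := 1 / 3) (d := n / 4) {1, -1}
    (by norm_num) (by norm_num) hV (fun w hw => by
      obtain ⟨v, hv, rfl | hlt⟩ := hcov w hw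
      · exact ⟨v, hv, by rw [hammingDist_self, Nat.cast_zero]; positivity⟩
      · exact ⟨v, hv, hlt.le⟩)
  rw [Finset.card_pair (by norm_num), Fintype.card_fin] at hbound
  norm_num only at hbound
  calc Real.exp ((n : ℝ) / 8) = Real.exp (1 / 8) ^ n := by
        rw [← Real.exp_nat_mul]
        ring_nf
    _ ≤ (3 / 2 * (1 / 3 : ℝ) ^ (1 / 4 : ℝ)) ^ n := by
        gcongr
        exact exp_one_eighth_le
    _ = (1 / 3 : ℝ) ^ ((n : ℝ) / 4) * 2 ^ n / (4 / 3) ^ n := by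
        rw [mul_pow, ← Real.rpow_mul_natCast (by norm_num), mul_div_assoc, ← div_pow]
        norm_num
        ring_nf
    _ ≤ V.card := by
        rw [div_le_iff₀ (by positivity)]
        exact hbound
end

section
/- Let n ≥ 1 and μ ≥ 0. Let r_1, …, r_n ∈ ℝ³ with ‖r_i‖ ≤ 1 for all i, let m_1, …, m_n ∈ ℝ³ be unit vectors, and let α_i := ∠(r_i, m_i) be the angle between r_i and m_i. If ∑_{i=1}^n ⟨r_i, m_i⟩ ≥ n − μ, then ∑_{i=1}^n α_i² ≤ 10μ and ∑_{i=1}^n α_i ≤ √(10·n·μ). -/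
open Real InnerProductGeometry
open scoped RealInnerProductSpace

/-- The squared angle between a vector of the unit ball and a unit vector is controlled by the
defect of their inner product. -/
lemma sq_angle_le_ten_mul_one_sub_inner {V : Type*} [NormedAddCommGroup V]
    [InnerProductSpace ℝ V] {x y : V} (hx : ‖x‖ ≤ 1) (hy : ‖y‖ = 1) :
    angle x y ^ 2 ≤ 10 * (1 - ⟪x, y⟫) := by
  have h0 := angle_nonneg x y
  have hle := angle_le_pi x y
  have hpi : π ^ 2 ≤ 10 := by nlinarith [pi_pos, pi_lt_d2]
  have hsq : angle x y ^ 2 ≤ π ^ 2 := by gcongr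
  have hcos := cos_angle_mul_norm_mul_norm x y
  rw [hy, mul_one] at hcos
  rcases le_total (cos (angle x y)) 0 with hc | hc
  · nlinarith [norm_nonneg x]
  · have hinner : ⟪x, y⟫ ≤ cos (angle x y) := by nlinarith
    have hbound := cos_le_one_sub_mul_cos_sq (abs_le.2 ⟨by linarith [pi_pos], hle⟩)
    have hcoef : (1 : ℝ) / 5 ≤ 2 / π ^ 2 := by
      rw [div_le_div_iff₀ (by norm_num) (by positivity)]
      linarith
    nlinarith [sq_nonneg (angle x y)]

/-- If vectors `rᵢ ∈ ℝ³` with `‖rᵢ‖ ≤ 1` and unit vectors `mᵢ` satisfy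
`∑ᵢ ⟨rᵢ, mᵢ⟩ ≥ n - μ`, then the angles `αᵢ = ∠(rᵢ, mᵢ)` satisfy `∑ᵢ αᵢ² ≤ 10μ` and
`∑ᵢ αᵢ ≤ √(10 n μ)`. -/
theorem angle_bounds_from_energy (n : ℕ) (hn : 1 ≤ n) (μ : ℝ) (hμ : 0 ≤ μ)
    (r m : Fin n → EuclideanSpace ℝ (Fin 3))
    (hr : ∀ i, ‖r i‖ ≤ 1) (hm : ∀ i, ‖m i‖ = 1)
    (h : (n : ℝ) - μ ≤ ∑ i : Fin n, ⟪r i, m i⟫) :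
    (∑ i : Fin n, angle (r i) (m i) ^ 2 ≤ 10 * μ) ∧
    (∑ i : Fin n, angle (r i) (m i) ≤ Real.sqrt (10 * n * μ)) := by
  have hsq : ∑ i : Fin n, angle (r i) (m i) ^ 2 ≤ 10 * μ := by
    calc ∑ i : Fin n, angle (r i) (m i) ^ 2
        ≤ ∑ i : Fin n, 10 * (1 - ⟪r i, m i⟫) :=
          Finset.sum_le_sum fun i _ => sq_angle_le_ten_mul_one_sub_inner (hr i) (hm i)
      _ = 10 * (n - ∑ i : Fin n, ⟪r i, m i⟫) := by
          rw [← Finset.mul_sum, Finset.sum_sub_distrib]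
          simp
      _ ≤ 10 * μ := by linarith
  refine ⟨hsq, Real.le_sqrt_of_sq_le ?_⟩
  calc (∑ i : Fin n, angle (r i) (m i)) ^ 2
      ≤ n * ∑ i : Fin n, angle (r i) (m i) ^ 2 := by
        simpa using sq_sum_le_card_mul_sum_sq (s := Finset.univ)
          (f := fun i : Fin n => angle (r i) (m i))
    _ ≤ n * (10 * μ) := by gcongr
    _ = 10 * n * μ := by ring
end

section
/- Let r ∈ ℝ³ with ‖r‖ ≤ 1, let δ ∈ [0, π/4], and let u ∈ {−1, 1}. Then |⟨r, ŵ⟩| ≤ ∠(r, n̂^{uδ}) + δ, where ŵ := (1/√2, 0, −1/√2) and n̂^θ := (sin(π/4 + θ), 0, cos(π/4 + θ)). -/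
open Real InnerProductGeometry
open scoped RealInnerProductSpace

/-- The unit vector `n̂^θ = (sin(π/4+θ), 0, cos(π/4+θ)) ∈ ℝ³`. -/
noncomputable def nhat (θ : ℝ) : EuclideanSpace ℝ (Fin 3) :=
  (WithLp.equiv 2 (Fin 3 → ℝ)).symm ![Real.sin (π/4 + θ), 0, Real.cos (π/4 + θ)]

/-- The vector `ŵ = (1/√2, 0, -1/√2) ∈ ℝ³`. -/
noncomputable def what : EuclideanSpace ℝ (Fin 3) :=
  (WithLp.equiv 2 (Fin 3 → ℝ)).symm ![1 / Real.sqrt 2, 0, -(1 / Real.sqrt 2)]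

theorem norm_nhat (θ : ℝ) : ‖nhat θ‖ = 1 := by
  simp [nhat, EuclideanSpace.norm_eq, Fin.sum_univ_three]

theorem norm_what : ‖what‖ = 1 := by
  simp [what, EuclideanSpace.norm_eq, Fin.sum_univ_three]
  norm_num

theorem inner_nhat_what (θ : ℝ) : ⟪nhat θ, what⟫ = Real.sin θ := by
  simp only [nhat, what, PiLp.inner_apply, Fin.sum_univ_three, Real.sin_add, Real.cos_add]
  simp
  field_simp
  ring

theorem angle_nhat_what {θ : ℝ} (h₁ : -(π / 2) ≤ θ) (h₂ : θ ≤ π / 2) :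
    angle (nhat θ) what = π / 2 - θ := by
  rw [angle, norm_nhat, norm_what, inner_nhat_what, mul_one, div_one, ← Real.cos_pi_div_two_sub,
    Real.arccos_cos (by linarith) (by linarith)]

theorem abs_inner_le_abs_pi_div_two_sub_angle {V : Type*} [NormedAddCommGroup V]
    [InnerProductSpace ℝ V] {x y : V} (hx : ‖x‖ ≤ 1) (hy : ‖y‖ ≤ 1) :
    |⟪x, y⟫| ≤ |π / 2 - angle x y| := by
  rw [← cos_angle_mul_norm_mul_norm, abs_mul, abs_of_nonneg (by positivity : 0 ≤ ‖x‖ * ‖y‖)]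
  calc |Real.cos (angle x y)| * (‖x‖ * ‖y‖)
      ≤ |Real.cos (angle x y)| :=
        mul_le_of_le_one_right (abs_nonneg _) (mul_le_one₀ hx (norm_nonneg y) hy)
    _ = |Real.sin (π / 2 - angle x y)| := by rw [Real.sin_pi_div_two_sub]
    _ ≤ |π / 2 - angle x y| := Real.abs_sin_le_abs

/-- For `‖r‖ ≤ 1`, `δ ∈ [0, π/4]` and `u ∈ {-1,1}`:
`|⟨r, ŵ⟩| ≤ ∠(r, n̂^{uδ}) + δ`. -/
theorem inner_what_le_angle_add (r : EuclideanSpace ℝ (Fin 3)) (hr : ‖r‖ ≤ 1)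
    (δ : ℝ) (hδ0 : 0 ≤ δ) (hδ : δ ≤ π / 4) (u : ℝ) (hu : u = 1 ∨ u = -1) :
    |⟪r, what⟫| ≤ angle r (nhat (u * δ)) + δ := by
  have hθ : |u * δ| ≤ δ := by
    rcases hu with rfl | rfl <;> simp [abs_of_nonneg hδ0]
  obtain ⟨hθ₁, hθ₂⟩ := abs_le.mp hθ
  have hw : angle (nhat (u * δ)) what = π / 2 - u * δ :=
    angle_nhat_what (by linarith [Real.pi_pos]) (by linarith [Real.pi_pos])
  have hrw := angle_le_angle_add_angle r (nhat (u * δ)) what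
  have hnw := angle_le_angle_add_angle (nhat (u * δ)) r what
  rw [angle_comm (nhat (u * δ)) r] at hnw
  refine (abs_inner_le_abs_pi_div_two_sub_angle hr norm_what.le).trans (abs_le.mpr ⟨?_, ?_⟩) <;>
    linarith
end

section
/- For all real numbers q, r ∈ (0,1): q·log₂(q/r) + (1−q)·log₂((1−q)/(1−r)) ≤ (q−r)² / ((ln 2)·r·(1−r)). In other words, the Kullback–Leibler divergence in bits between the Bernoulli distributions with success probabilities q and r is at most (1/ln 2)·(q−r)²/(r(1−r)). -/
/-- The KL divergence in bits between Bernoulli distributions with parameters `q, r ∈ (0,1)`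
satisfies `q log₂(q/r) + (1-q) log₂((1-q)/(1-r)) ≤ (q-r)² / (ln 2 · r(1-r))`. -/
theorem bernoulli_kl_le (q r : ℝ) (hq : q ∈ Set.Ioo (0 : ℝ) 1) (hr : r ∈ Set.Ioo (0 : ℝ) 1) :
    q * Real.logb 2 (q / r) + (1 - q) * Real.logb 2 ((1 - q) / (1 - r)) ≤
      (q - r) ^ 2 / (Real.log 2 * r * (1 - r)) := by
  obtain ⟨hq0, hq1⟩ := hq
  obtain ⟨hr0, hr1⟩ := hr
  have hq1' : 0 < 1 - q := sub_pos.2 hq1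
  have hr1' : 0 < 1 - r := sub_pos.2 hr1
  have hlog : 0 < Real.log 2 := Real.log_pos one_lt_two
  have h₁ := Real.log_le_sub_one_of_pos (div_pos hq0 hr0)
  have h₂ := Real.log_le_sub_one_of_pos (div_pos hq1' hr1')
  calc q * Real.logb 2 (q / r) + (1 - q) * Real.logb 2 ((1 - q) / (1 - r))
      = (q * Real.log (q / r) + (1 - q) * Real.log ((1 - q) / (1 - r))) / Real.log 2 := by
        simp only [Real.logb]
        ring
    _ ≤ (q * (q / r - 1) + (1 - q) * ((1 - q) / (1 - r) - 1)) / Real.log 2 := by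
        gcongr
    _ = (q - r) ^ 2 / (Real.log 2 * r * (1 - r)) := by
        field_simp
        ring
end

section
/- Let n ≥ 1, δ ∈ ℝ, v ∈ {−1,1}ⁿ, and θ ∈ ℝⁿ. Define ψ_θ ∈ ℂ^{2ⁿ} (indexed by f : Fin n → Fin 2) by ψ_θ(f) = ∏_{j=1}^n c_j(f j), where c_j(0) = cos((θ_j + π/4)/2) and c_j(1) = sin((θ_j + π/4)/2). Then ψ_θ is a unit vector and ⟨ψ_θ, H_v^δ ψ_θ⟩ = −∑_{i=1}^n cos(θ_i − δ v_i). -/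
open Matrix Real Finset

/-- The product-state ansatz `ψ_θ(f) = ∏ⱼ cⱼ(f j)` with `cⱼ(0) = cos((θⱼ+π/4)/2)` and
`cⱼ(1) = sin((θⱼ+π/4)/2)`. -/
noncomputable def ansatz (n : ℕ) (θ : Fin n → ℝ) : (Fin n → Fin 2) → ℂ :=
  fun f => ∏ j : Fin n,
    (if f j = 0 then ((Real.cos ((θ j + π/4) / 2) : ℝ) : ℂ)
     else ((Real.sin ((θ j + π/4) / 2) : ℝ) : ℂ))

/-- The quadratic form of a tensor product of matrices at a product vector factorizes. -/
theorem qform_prod {ι κ : Type*} [Fintype ι] [DecidableEq ι] [Fintype κ]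
    (M : ι → Matrix κ κ ℂ) (c : ι → κ → ℂ) :
    qform (fun f g : ι → κ => ∏ j, M j (f j) (g j)) (fun f => ∏ j, c j (f j)) =
      ∏ j, qform (M j) (c j) := by
  simp only [qform, dotProduct, mulVec, Pi.star_apply, star_prod, Fintype.prod_sum,
    Finset.prod_mul_distrib]

/-- The matrix acting as `A` on qubit `i` and as the identity on the other qubits. -/
def siteMatrix {n : ℕ} (i : Fin n) (A : Matrix (Fin 2) (Fin 2) ℂ) :
    Matrix (Fin n → Fin 2) (Fin n → Fin 2) ℂ :=
  fun f g => ∏ j, (Function.update (fun _ => (1 : Matrix (Fin 2) (Fin 2) ℂ)) i A) j (f j) (g j)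

theorem siteMatrix_apply {n : ℕ} (i : Fin n) (A : Matrix (Fin 2) (Fin 2) ℂ)
    (f g : Fin n → Fin 2) :
    siteMatrix i A f g = if ∀ j, j ≠ i → f j = g j then A (f i) (g i) else 0 := by
  rw [siteMatrix, ← Finset.mul_prod_erase _ _ (Finset.mem_univ i), Function.update_self,
    Finset.prod_congr rfl (g := fun j => if f j = g j then (1 : ℂ) else 0), Finset.prod_ite_zero]
  · simp
  · intro j hj
    rw [Function.update_of_ne (Finset.ne_of_mem_erase hj), one_apply]

theorem pauliX_eq_siteMatrix {n : ℕ} (i : Fin n) :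
    pauliX n i = siteMatrix i !![0, 1; 1, 0] := by
  ext f g
  rw [siteMatrix_apply, pauliX]
  by_cases h : ∀ j, j ≠ i → f j = g j
  · simp only [and_iff_left h, if_pos h]
    generalize f i = a, g i = b
    fin_cases a <;> fin_cases b <;> simp
  · rw [if_neg h, if_neg fun h' => h h'.2]

theorem pauliZ_eq_siteMatrix {n : ℕ} (i : Fin n) :
    pauliZ n i = siteMatrix i !![1, 0; 0, -1] := by
  ext f g
  have hfg : f = g ↔ f i = g i ∧ ∀ j, j ≠ i → f j = g j :=
    ⟨fun h => h ▸ ⟨rfl, fun _ _ => rfl⟩, fun h => funext fun j =>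
      (eq_or_ne j i).elim (fun e => e ▸ h.1) (h.2 j)⟩
  rw [siteMatrix_apply, pauliZ]
  simp only [hfg]
  by_cases h : ∀ j, j ≠ i → f j = g j
  · simp only [and_iff_left h, if_pos h]
    generalize f i = a, g i = b
    fin_cases a <;> fin_cases b <;> simp
  · rw [if_neg h, if_neg fun h' => h h'.2]

/-- The single-qubit state whose tensor products form the ansatz. -/
noncomputable def qubitState (t : ℝ) : Fin 2 → ℂ :=
  fun a => if a = 0 then ((Real.cos ((t + π/4) / 2) : ℝ) : ℂ)
    else ((Real.sin ((t + π/4) / 2) : ℝ) : ℂ)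

theorem ansatz_eq_prod (n : ℕ) (θ : Fin n → ℝ) :
    ansatz n θ = fun f => ∏ j, qubitState (θ j) (f j) := rfl

theorem qform_one_qubitState (t : ℝ) : qform 1 (qubitState t) = 1 := by
  simp only [qform, one_mulVec, dotProduct, Fin.sum_univ_two, qubitState, Pi.star_apply,
    Complex.star_def, if_true, if_neg one_ne_zero, Complex.conj_ofReal]
  norm_cast
  linarith [Real.cos_sq_add_sin_sq ((t + π/4) / 2)]

theorem qform_X_qubitState (t : ℝ) :
    qform !![0, 1; 1, 0] (qubitState t) = (Real.sin (t + π/4) : ℝ) := by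
  have h := Real.sin_two_mul ((t + π/4) / 2)
  rw [mul_div_cancel₀ _ two_ne_zero] at h
  simp only [h, qform, mulVec, dotProduct, Fin.sum_univ_two, qubitState, Pi.star_apply,
    Complex.star_def, if_true, if_neg one_ne_zero, Complex.conj_ofReal, of_apply, cons_val_zero,
    cons_val_one, cons_val_fin_one]
  push_cast
  ring

theorem qform_Z_qubitState (t : ℝ) :
    qform !![1, 0; 0, -1] (qubitState t) = (Real.cos (t + π/4) : ℝ) := by
  have h := Real.cos_two_mul' ((t + π/4) / 2)
  rw [mul_div_cancel₀ _ two_ne_zero] at h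
  simp only [h, qform, mulVec, dotProduct, Fin.sum_univ_two, qubitState, Pi.star_apply,
    Complex.star_def, if_true, if_neg one_ne_zero, Complex.conj_ofReal, of_apply, cons_val_zero,
    cons_val_one, cons_val_fin_one]
  push_cast
  ring

theorem qform_siteMatrix_ansatz {n : ℕ} (i : Fin n) (A : Matrix (Fin 2) (Fin 2) ℂ)
    (θ : Fin n → ℝ) : qform (siteMatrix i A) (ansatz n θ) = qform A (qubitState (θ i)) := by
  rw [ansatz_eq_prod]
  refine (qform_prod _ _).trans ?_
  rw [Finset.prod_eq_single i, Function.update_self]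
  · intro j _ hj
    rw [Function.update_of_ne hj, qform_one_qubitState]
  · simp

theorem star_ansatz_dotProduct_self (n : ℕ) (θ : Fin n → ℝ) :
    star (ansatz n θ) ⬝ᵥ ansatz n θ = 1 := by
  simp only [ansatz_eq_prod, dotProduct, Pi.star_apply, star_prod, ← Finset.prod_mul_distrib]
  rw [← Fintype.prod_sum (fun j a => star (qubitState (θ j) a) * qubitState (θ j) a)]
  refine Finset.prod_eq_one fun j _ => ?_
  simpa [qform, dotProduct] using qform_one_qubitState (θ j)

/-- The ansatz state `ψ_θ` is a unit vector, and the induced objective function is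
`⟨ψ_θ, H_v^δ ψ_θ⟩ = -∑ᵢ cos(θᵢ - δ vᵢ)`. -/
theorem ansatz_energy (n : ℕ) (hn : 1 ≤ n) (δ : ℝ) (v : Fin n → ℝ)
    (hv : ∀ i, v i = 1 ∨ v i = -1) (θ : Fin n → ℝ) :
    star (ansatz n θ) ⬝ᵥ ansatz n θ = 1 ∧
    qform (Ham n δ v) (ansatz n θ) = ((- ∑ i : Fin n, Real.cos (θ i - δ * v i) : ℝ) : ℂ) := by
  refine ⟨star_ansatz_dotProduct_self n θ, ?_⟩
  have key : qform (Ham n δ v) (ansatz n θ) =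
      -∑ i, (((Real.sin (π/4 + v i * δ) : ℝ) : ℂ) * qform (pauliX n i) (ansatz n θ)
        + ((Real.cos (π/4 + v i * δ) : ℝ) : ℂ) * qform (pauliZ n i) (ansatz n θ)) := by
    simp only [qform, Ham, neg_mulVec, sum_mulVec, add_mulVec, smul_mulVec, dotProduct_neg,
      dotProduct_sum, dotProduct_add, dotProduct_smul, smul_eq_mul]
  rw [key]
  simp only [pauliX_eq_siteMatrix, pauliZ_eq_siteMatrix, qform_siteMatrix_ansatz,
    qform_X_qubitState, qform_Z_qubitState]
  norm_cast
  refine congrArg Neg.neg (Finset.sum_congr rfl fun i _ => ?_)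
  rw [show θ i - δ * v i = (θ i + π/4) - (π/4 + v i * δ) by ring, Real.cos_sub]
  ring
end

section
/- Let n ≥ 1, let 0 < δ ≤ 0.7, and let v ∈ ℝⁿ with v_i ∈ {−1,1} for all i. The function f : EuclideanSpace ℝ (Fin n) → ℝ defined by f(θ) = −∑_{i=1}^n cos(θ_i − δ v_i) is 0.1-strongly convex with respect to the Euclidean norm on the box B_∞(δ) := {θ : |θ_i| ≤ δ for all i}; that is, the function θ ↦ f(θ) − (0.1/2)·‖θ‖₂² is convex on B_∞(δ). -/
open Real

theorem one_tenth_le_cos {x : ℝ} (hx : |x| ≤ 1.4) : 0.1 ≤ cos x := by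
  have hsq : x ^ 2 ≤ 1.4 ^ 2 := sq_le_sq' (neg_le_of_abs_le hx) (le_of_abs_le hx)
  have hhalf := one_sub_sq_div_two_le_cos (x := x / 2)
  have hdouble : cos x = 2 * cos (x / 2) ^ 2 - 1 := by
    rw [← cos_two_mul, mul_div_cancel₀ x two_ne_zero]
  nlinarith

theorem convexOn_neg_cos_sub_sub_sq {δ c : ℝ} (h : δ + |c| ≤ 1.4) :
    ConvexOn ℝ (Set.Icc (-δ) δ) fun t => -cos (t - c) - 0.1 / 2 * t ^ 2 := by
  refine convexOn_of_hasDerivWithinAt2_nonneg (convex_Icc _ _) (by fun_prop)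
    (f' := fun t => sin (t - c) - 0.1 * t) (f'' := fun t => cos (t - c) - 0.1) ?_ ?_ ?_
  · intro t _
    have hd := ((hasDerivAt_id t).sub_const c).cos.neg.sub
      (((hasDerivAt_id t).pow 2).const_mul (0.1 / 2 : ℝ))
    refine HasDerivAt.hasDerivWithinAt (hd.congr_deriv ?_)
    simp
    ring
  · intro t _
    have hd := ((hasDerivAt_id t).sub_const c).sin.sub ((hasDerivAt_id t).const_mul (0.1 : ℝ))
    refine HasDerivAt.hasDerivWithinAt (hd.congr_deriv ?_)
    simp
  · intro t ht
    have habs : |t| ≤ δ := abs_le.2 (Set.mem_Icc.1 (interior_subset ht))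
    exact sub_nonneg.2 (one_tenth_le_cos ((abs_sub t c).trans (by linarith)))

/-- The induced objective function `f(θ) = -∑ᵢ cos(θᵢ - δ vᵢ)` of the observable `H_v^δ`
under the product-state ansatz is `0.1`-strongly convex w.r.t. the Euclidean norm on the box
`B_∞(δ) = {θ : |θᵢ| ≤ δ ∀i}`: the function `θ ↦ f(θ) - (0.1/2)‖θ‖₂²` is convex there. -/
theorem strong_convexity_on_box (n : ℕ) (hn : 1 ≤ n) (δ : ℝ) (hδ0 : 0 < δ) (hδ : δ ≤ 0.7)
    (v : Fin n → ℝ) (hv : ∀ i, v i = 1 ∨ v i = -1) :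
    ConvexOn ℝ {θ : EuclideanSpace ℝ (Fin n) | ∀ i, |θ i| ≤ δ}
      (fun θ : EuclideanSpace ℝ (Fin n) =>
        (- ∑ i : Fin n, Real.cos (θ i - δ * v i)) - 0.1 / 2 * ‖θ‖ ^ 2) := by
  have hcoord (i : Fin n) : ConvexOn ℝ (Set.Icc (-δ) δ)
      fun t => -cos (t - δ * v i) - 0.1 / 2 * t ^ 2 := by
    apply convexOn_neg_cos_sub_sub_sq
    have hvi : |v i| = 1 := by rcases hv i with h | h <;> simp [h]
    rw [abs_mul, hvi, abs_of_pos hδ0]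
    linarith
  have hsum : (fun θ : EuclideanSpace ℝ (Fin n) =>
      (- ∑ i : Fin n, cos (θ i - δ * v i)) - 0.1 / 2 * ‖θ‖ ^ 2) =
      fun θ => ∑ i, (-cos (θ i - δ * v i) - 0.1 / 2 * θ i ^ 2) := by
    ext θ
    rw [EuclideanSpace.real_norm_sq_eq, Finset.sum_sub_distrib, Finset.sum_neg_distrib,
      Finset.mul_sum]
  rw [hsum]
  refine ⟨fun x hx y hy a b ha hb hab i => ?_, fun x hx y hy a b ha hb hab => ?_⟩
  · exact abs_le.2 ((convex_Icc (-δ) δ) (abs_le.1 (hx i)) (abs_le.1 (hy i)) ha hb hab)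
  · rw [Finset.smul_sum, Finset.smul_sum, ← Finset.sum_add_distrib]
    exact Finset.sum_le_sum fun i _ =>
      (hcoord i).2 (abs_le.1 (hx i)) (abs_le.1 (hy i)) ha hb hab
end

section
/- Let n ≥ 1 and ε > 0, set δ := √(45ε/n), and assume δ ≤ 0.7. Let V ⊆ {−1,1}ⁿ satisfy Δ(v,v′) ≥ n/4 for all distinct v, v′ ∈ V. Let (Ω, P) be a probability space and ψ : Ω → ℂ^{2ⁿ} a measurable map with ‖ψ(ω)‖ = 1 almost surely. If some v ∈ V satisfies E[⟨ψ, H_v^δ ψ⟩] + n ≤ ε, then with probability at least 2/3, ⟨ψ, H_v^δ ψ⟩ < ⟨ψ, H_{v′}^δ ψ⟩ for every v′ ∈ V with v′ ≠ v; that is, any procedure that optimizes the family {H_v^δ : v ∈ V} to expected precision ε identifies the hidden parameter v with probability at least 2/3. -/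
open Matrix Real Finset

open MeasureTheory
open scoped ENNReal

/-- Flip the `i`-th bit of a configuration. -/
def flipBit {n : ℕ} (i : Fin n) (f : Fin n → Fin 2) : Fin n → Fin 2 :=
  Function.update f i (1 - f i)

theorem flipBit_involutive {n : ℕ} (i : Fin n) : Function.Involutive (flipBit i) := by
  intro f
  ext j
  by_cases h : j = i
  · subst h
    simp [flipBit]
  · simp [flipBit, h]

theorem neg_one_pow_flipBit {n : ℕ} (i : Fin n) (f : Fin n → Fin 2) :
    (-1 : ℝ) ^ ((flipBit i f i : ℕ)) = -(-1 : ℝ) ^ ((f i : ℕ)) := by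
  simp only [flipBit, Function.update_self]
  generalize f i = a
  fin_cases a <;> simp

theorem pauliX_apply_eq_ite {n : ℕ} (i : Fin n) (f g : Fin n → Fin 2) :
    pauliX n i f g = if g = flipBit i f then 1 else 0 := by
  unfold pauliX
  congr 1
  rw [eq_iff_iff]
  constructor
  · rintro ⟨h, h'⟩
    ext j
    by_cases hj : j = i
    · subst hj
      simp only [flipBit, Function.update_self]
      omega
    · simp [flipBit, hj, h' j hj]
  · rintro rfl
    refine ⟨?_, fun j hj => by simp [flipBit, hj]⟩
    simp only [flipBit, Function.update_self]
    omega

theorem re_qform_pauliX {n : ℕ} (i : Fin n) (ψ : (Fin n → Fin 2) → ℂ) :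
    (qform (pauliX n i) ψ).re = ∑ f, ((ψ f).re * (ψ (flipBit i f)).re
      + (ψ f).im * (ψ (flipBit i f)).im) := by
  simp [qform, dotProduct, mulVec, pauliX_apply_eq_ite]

theorem re_qform_pauliZ {n : ℕ} (i : Fin n) (ψ : (Fin n → Fin 2) → ℂ) :
    (qform (pauliZ n i) ψ).re
      = ∑ f, (-1 : ℝ) ^ ((f i : ℕ)) * ((ψ f).re ^ 2 + (ψ f).im ^ 2) := by
  simp only [qform, dotProduct, mulVec, pauliZ, ite_mul, zero_mul, Finset.sum_ite_eq,
    Finset.mem_univ, if_true, Complex.re_sum]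
  refine Finset.sum_congr rfl fun f _ => ?_
  generalize f i = a
  fin_cases a <;> simp <;> ring

theorem add_mul_le_of_sq_add_sq_eq_one {s c : ℝ} (h : s ^ 2 + c ^ 2 = 1) (p q : ℝ) :
    2 * s * (p * q) + c * (p ^ 2 - q ^ 2) ≤ p ^ 2 + q ^ 2 := by
  have h1 := sq_nonneg ((1 - c) * p - s * q)
  have h2 := sq_nonneg ((1 + c) * q - s * p)
  have h3 : ((1 - c) * p - s * q) ^ 2 + ((1 + c) * q - s * p) ^ 2
      = 2 * (p ^ 2 + q ^ 2 - (2 * s * (p * q) + c * (p ^ 2 - q ^ 2))) := by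
    linear_combination (p ^ 2 + q ^ 2) * h
  linarith

/-- A single-qubit observable `s X + c Z` with `s² + c² = 1` is at most the identity. -/
theorem re_qform_pauli_le {n : ℕ} (i : Fin n) (ψ : (Fin n → Fin 2) → ℂ)
    (hψ : ∑ f, ((ψ f).re ^ 2 + (ψ f).im ^ 2) = 1) {s c : ℝ} (h : s ^ 2 + c ^ 2 = 1) :
    s * (qform (pauliX n i) ψ).re + c * (qform (pauliZ n i) ψ).re ≤ 1 := by
  let e := (flipBit_involutive i).toPerm
  have hN := Equiv.sum_comp e fun f => (ψ f).re ^ 2 + (ψ f).im ^ 2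
  have hZ := Equiv.sum_comp e fun f => (-1 : ℝ) ^ ((f i : ℕ)) * ((ψ f).re ^ 2 + (ψ f).im ^ 2)
  simp only [e, Function.Involutive.coe_toPerm, neg_one_pow_flipBit] at hN hZ
  rw [← re_qform_pauliZ] at hZ
  have key : ∑ f, (2 * s * ((ψ f).re * (ψ (flipBit i f)).re + (ψ f).im * (ψ (flipBit i f)).im)
      + c * ((-1 : ℝ) ^ ((f i : ℕ)) * ((ψ f).re ^ 2 + (ψ f).im ^ 2)
        + -(-1 : ℝ) ^ ((f i : ℕ)) * ((ψ (flipBit i f)).re ^ 2 + (ψ (flipBit i f)).im ^ 2)))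
      ≤ ∑ f, (((ψ f).re ^ 2 + (ψ f).im ^ 2)
        + ((ψ (flipBit i f)).re ^ 2 + (ψ (flipBit i f)).im ^ 2)) := by
    refine Finset.sum_le_sum fun f _ => ?_
    have hc : s ^ 2 + (c * (-1 : ℝ) ^ ((f i : ℕ))) ^ 2 = 1 := by
      rw [mul_pow, ← pow_mul, mul_comm _ 2, pow_mul]
      simpa using h
    have h1 := add_mul_le_of_sq_add_sq_eq_one hc (ψ f).re (ψ (flipBit i f)).re
    have h2 := add_mul_le_of_sq_add_sq_eq_one hc (ψ f).im (ψ (flipBit i f)).im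
    linarith
  have hR := Finset.sum_add_distrib (s := Finset.univ)
    (f := fun f => (ψ f).re ^ 2 + (ψ f).im ^ 2)
    (g := fun f => (ψ (flipBit i f)).re ^ 2 + (ψ (flipBit i f)).im ^ 2)
  have hL := Finset.sum_add_distrib (s := Finset.univ)
    (f := fun f => (-1 : ℝ) ^ ((f i : ℕ)) * ((ψ f).re ^ 2 + (ψ f).im ^ 2))
    (g := fun f => -(-1 : ℝ) ^ ((f i : ℕ)) *
      ((ψ (flipBit i f)).re ^ 2 + (ψ (flipBit i f)).im ^ 2))
  rw [hN, hψ] at hR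
  rw [hZ, ← re_qform_pauliZ] at hL
  rw [hR, Finset.sum_add_distrib, ← Finset.mul_sum, ← Finset.mul_sum, ← re_qform_pauliX,
    hL] at key
  linarith

theorem re_qform_Ham (n : ℕ) (δ : ℝ) (v : Fin n → ℝ) (ψ : (Fin n → Fin 2) → ℂ) :
    (qform (Ham n δ v) ψ).re = -∑ i, (Real.sin (π / 4 + v i * δ) * (qform (pauliX n i) ψ).re
      + Real.cos (π / 4 + v i * δ) * (qform (pauliZ n i) ψ).re) := by
  simp only [qform, Ham, neg_mulVec, dotProduct_neg, sum_mulVec, dotProduct_sum, add_mulVec,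
    dotProduct_add, smul_mulVec, dotProduct_smul, Complex.neg_re, Complex.re_sum, Complex.add_re,
    smul_eq_mul, Complex.re_ofReal_mul]

theorem measurable_qform {m : Type*} [Fintype m] (M : Matrix m m ℂ) : Measurable (qform M) := by
  unfold qform dotProduct mulVec dotProduct
  simp only [Pi.star_apply]
  fun_prop

theorem abs_re_qform_Ham_le {n : ℕ} (δ : ℝ) (v : Fin n → ℝ) (ψ : (Fin n → Fin 2) → ℂ)
    (hψ : ∑ f, ((ψ f).re ^ 2 + (ψ f).im ^ 2) = 1) :
    |(qform (Ham n δ v) ψ).re| ≤ n := by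
  rw [re_qform_Ham, abs_neg]
  refine (Finset.abs_sum_le_sum_abs _ _).trans ?_
  refine (Finset.sum_le_card_nsmul _ _ 1 fun i _ => ?_).trans (by simp)
  have h := Real.sin_sq_add_cos_sq (π / 4 + v i * δ)
  have h1 := re_qform_pauli_le i ψ hψ h
  have h2 := re_qform_pauli_le i ψ hψ (s := -Real.sin (π / 4 + v i * δ))
    (c := -Real.cos (π / 4 + v i * δ)) (by linarith)
  rw [abs_le]
  constructor <;> linarith

/-- Hamiltonians with well-separated parameters cannot both have small energy. -/
theorem hammingDist_mul_le_re_qform_Ham_add {n : ℕ} (δ : ℝ) (v w : Fin n → ℝ)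
    (hv : ∀ i, v i = 1 ∨ v i = -1) (hw : ∀ i, w i = 1 ∨ w i = -1)
    (hδ : 0 ≤ Real.cos δ) (ψ : (Fin n → Fin 2) → ℂ)
    (hψ : ∑ f, ((ψ f).re ^ 2 + (ψ f).im ^ 2) = 1) :
    hammingDist v w * (2 * (1 - Real.cos δ))
      ≤ (qform (Ham n δ v) ψ).re + (qform (Ham n δ w) ψ).re + 2 * n := by
  have hr : (qform (Ham n δ v) ψ).re + (qform (Ham n δ w) ψ).re + 2 * n
      = ∑ i, ((1 - (Real.sin (π / 4 + v i * δ) * (qform (pauliX n i) ψ).re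
        + Real.cos (π / 4 + v i * δ) * (qform (pauliZ n i) ψ).re))
      + (1 - (Real.sin (π / 4 + w i * δ) * (qform (pauliX n i) ψ).re
        + Real.cos (π / 4 + w i * δ) * (qform (pauliZ n i) ψ).re))) := by
    simp only [re_qform_Ham, Finset.sum_add_distrib, Finset.sum_sub_distrib, Finset.sum_const,
      Finset.card_univ, Fintype.card_fin, nsmul_eq_mul]
    ring
  have hl : hammingDist v w * (2 * (1 - Real.cos δ))
      = ∑ i, if v i ≠ w i then 2 * (1 - Real.cos δ) else 0 := by
    rw [← Finset.sum_filter, Finset.sum_const, nsmul_eq_mul]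
    rfl
  rw [hr, hl]
  refine Finset.sum_le_sum fun i _ => ?_
  have h1 := re_qform_pauli_le i ψ hψ (Real.sin_sq_add_cos_sq (π / 4 + v i * δ))
  have h2 := re_qform_pauli_le i ψ hψ (Real.sin_sq_add_cos_sq (π / 4 + w i * δ))
  have h0 := re_qform_pauli_le i ψ hψ (Real.sin_sq_add_cos_sq (π / 4))
  split_ifs with hne
  · have hs : Real.sin (π / 4 + v i * δ) + Real.sin (π / 4 + w i * δ)
        = 2 * Real.cos δ * Real.sin (π / 4) := by
      rcases hv i with h | h <;> rcases hw i with h' | h' <;> simp only [h, h'] at hne ⊢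
      · simp at hne
      · simp only [Real.sin_add, neg_one_mul, one_mul, Real.sin_neg, Real.cos_neg]
        ring
      · simp only [Real.sin_add, neg_one_mul, one_mul, Real.sin_neg, Real.cos_neg]
        ring
      · simp at hne
    have hc : Real.cos (π / 4 + v i * δ) + Real.cos (π / 4 + w i * δ)
        = 2 * Real.cos δ * Real.cos (π / 4) := by
      rcases hv i with h | h <;> rcases hw i with h' | h' <;> simp only [h, h'] at hne ⊢
      · simp at hne
      · simp only [Real.cos_add, neg_one_mul, one_mul, Real.sin_neg, Real.cos_neg]
        ring
      · simp only [Real.cos_add, neg_one_mul, one_mul, Real.sin_neg, Real.cos_neg]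
        ring
      · simp at hne
    have hm := mul_le_mul_of_nonneg_left h0 hδ
    have : (Real.sin (π / 4 + v i * δ) * (qform (pauliX n i) ψ).re
        + Real.cos (π / 4 + v i * δ) * (qform (pauliZ n i) ψ).re)
        + (Real.sin (π / 4 + w i * δ) * (qform (pauliX n i) ψ).re
        + Real.cos (π / 4 + w i * δ) * (qform (pauliZ n i) ψ).re)
        = 2 * (Real.cos δ * (Real.sin (π / 4) * (qform (pauliX n i) ψ).re
          + Real.cos (π / 4) * (qform (pauliZ n i) ψ).re)) := by
      linear_combination (qform (pauliX n i) ψ).re * hs + (qform (pauliZ n i) ψ).re * hc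
    linarith
  · linarith

theorem four_fifteenths_mul_sq_le_one_sub_cos {x : ℝ} (h0 : 0 ≤ x) (h1 : x ≤ 0.7) :
    4 / 15 * x ^ 2 ≤ 1 - Real.cos x := by
  have h := (abs_le.1 (Real.cos_bound (abs_le.2 ⟨by linarith, by linarith⟩ : |x| ≤ 1))).2
  rw [abs_of_nonneg h0] at h
  have : x ^ 2 ≤ 0.49 := by nlinarith
  nlinarith [sq_nonneg x]

/-- A state of energy less than `3ε` for `Ham n δ v`, where `45ε = nδ²`, has larger energy for
every well-separated parameter `w`. -/
theorem re_qform_Ham_lt {n : ℕ} {δ ε : ℝ} (hδ0 : 0 ≤ δ) (hδ : δ ≤ 0.7)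
    (hε : n * δ ^ 2 = 45 * ε) (v w : Fin n → ℝ)
    (hv : ∀ i, v i = 1 ∨ v i = -1) (hw : ∀ i, w i = 1 ∨ w i = -1)
    (hvw : (n : ℝ) / 4 ≤ hammingDist v w) (ψ : (Fin n → Fin 2) → ℂ)
    (hψ : ∑ f, ((ψ f).re ^ 2 + (ψ f).im ^ 2) = 1)
    (hE : (qform (Ham n δ v) ψ).re + n < 3 * ε) :
    (qform (Ham n δ v) ψ).re < (qform (Ham n δ w) ψ).re := by
  by_contra! hle
  have hcos : 0 ≤ Real.cos δ :=
    Real.cos_nonneg_of_neg_pi_div_two_le_of_le (by linarith [Real.pi_pos])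
      (by linarith [Real.pi_gt_three])
  have h1 := hammingDist_mul_le_re_qform_Ham_add δ v w hv hw hcos ψ hψ
  have h2 := four_fifteenths_mul_sq_le_one_sub_cos hδ0 hδ
  have h3 := mul_le_mul_of_nonneg_right hvw
    (by linarith [Real.cos_le_one δ] : 0 ≤ 2 * (1 - Real.cos δ))
  have h4 := mul_le_mul_of_nonneg_left h2 (Nat.cast_nonneg (α := ℝ) n)
  linarith

/-- With `δ := √(45ε/n) ≤ 0.7` and `V ⊆ {-1,1}ⁿ` of pairwise Hamming distance `≥ n/4`:
if a random unit vector `ψ` optimizes some `H_v^δ` (for `v ∈ V`) to expected precision `ε`,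
i.e. `E[⟨ψ,H_v^δψ⟩] + n ≤ ε`, then with probability at least `2/3` the hidden parameter `v`
is the unique minimizer over `V` of `v' ↦ ⟨ψ, H_{v'}^δ ψ⟩`, so it is identified correctly. -/
theorem identify_hidden_parameter (n : ℕ) (hn : 1 ≤ n) (ε : ℝ) (hε : 0 < ε)
    (hδ : Real.sqrt (45 * ε / n) ≤ 0.7)
    (V : Finset (Fin n → ℝ)) (hV : ∀ v ∈ V, ∀ i, v i = 1 ∨ v i = -1)
    (hsep : ∀ v ∈ V, ∀ v' ∈ V, v ≠ v' → ((n : ℝ) / 4) ≤ hammingDist v v')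
    {Ω : Type*} [MeasurableSpace Ω] (P : Measure Ω) [IsProbabilityMeasure P]
    (ψ : Ω → (Fin n → Fin 2) → ℂ) (hmeas : Measurable ψ)
    (hunit : ∀ᵐ ω ∂P, ‖(EuclideanSpace.equiv (Fin n → Fin 2) ℂ).symm (ψ ω)‖ = 1)
    (v : Fin n → ℝ) (hv : v ∈ V)
    (hopt : (∫ ω, (qform (Ham n (Real.sqrt (45 * ε / n)) v) (ψ ω)).re ∂P) + n ≤ ε) :
    (2 / 3 : ℝ≥0∞) ≤ P {ω | ∀ v' ∈ V, v' ≠ v →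
      (qform (Ham n (Real.sqrt (45 * ε / n)) v) (ψ ω)).re <
        (qform (Ham n (Real.sqrt (45 * ε / n)) v') (ψ ω)).re} := by
  set δ := Real.sqrt (45 * ε / n) with hδ_def
  have hn0 : (0 : ℝ) < n := by exact_mod_cast hn
  have hδε : n * δ ^ 2 = 45 * ε := by
    rw [hδ_def, Real.sq_sqrt (by positivity)]
    field_simp
  have hunit' : ∀ᵐ ω ∂P, ∑ f, ((ψ ω f).re ^ 2 + (ψ ω f).im ^ 2) = 1 := by
    filter_upwards [hunit] with ω hω
    have h := EuclideanSpace.norm_sq_eq ((EuclideanSpace.equiv (Fin n → Fin 2) ℂ).symm (ψ ω))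
    rw [hω, one_pow] at h
    rw [h]
    refine Finset.sum_congr rfl fun f _ => ?_
    rw [← Complex.normSq_eq_norm_sq, Complex.normSq_apply, ← sq, ← sq]
    rfl
  have hqm : Measurable fun ω => (qform (Ham n δ v) (ψ ω)).re :=
    Complex.measurable_re.comp ((measurable_qform _).comp hmeas)
  have hqi : Integrable (fun ω => (qform (Ham n δ v) (ψ ω)).re) P := by
    refine Integrable.of_bound hqm.aestronglyMeasurable n ?_
    filter_upwards [hunit'] with ω hω
    exact abs_re_qform_Ham_le δ v (ψ ω) hω
  have hnonneg : 0 ≤ᵐ[P] fun ω => (qform (Ham n δ v) (ψ ω)).re + n := by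
    filter_upwards [hunit'] with ω hω
    have := (abs_le.1 (abs_re_qform_Ham_le δ v (ψ ω) hω)).1
    simp only [Pi.zero_apply]
    linarith
  have hmarkov := mul_meas_ge_le_integral_of_nonneg hnonneg
    (hqi.add (integrable_const (n : ℝ))) (3 * ε)
  rw [integral_add hqi (integrable_const _)] at hmarkov
  simp only [integral_const, probReal_univ, one_smul] at hmarkov
  have hbad : P.real {ω | 3 * ε ≤ (qform (Ham n δ v) (ψ ω)).re + n} ≤ 1 / 3 := by
    have := hmarkov.trans hopt
    rw [mul_assoc, mul_left_comm] at this
    have := le_of_mul_le_mul_left (this.trans_eq (mul_one ε).symm) hε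
    linarith
  have hms : MeasurableSet {ω | 3 * ε ≤ (qform (Ham n δ v) (ψ ω)).re + n} :=
    measurableSet_le measurable_const (hqm.add_const _)
  have hgood : 2 / 3 ≤ P.real {ω | 3 * ε ≤ (qform (Ham n δ v) (ψ ω)).re + n}ᶜ := by
    rw [probReal_compl_eq_one_sub hms]
    linarith
  calc (2 / 3 : ℝ≥0∞) = ENNReal.ofReal (2 / 3) := by
        rw [ENNReal.ofReal_div_of_pos (by norm_num)]
        simp
    _ ≤ P {ω | 3 * ε ≤ (qform (Ham n δ v) (ψ ω)).re + n}ᶜ :=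
        ENNReal.ofReal_le_of_le_toReal hgood
    _ ≤ _ := by
      refine measure_mono_ae ?_
      filter_upwards [hunit'] with ω hω hE v' hv' hne
      exact re_qform_Ham_lt (Real.sqrt_nonneg _) hδ hδε v v' (hV v hv) (hV v' hv')
        (hsep v hv v' hv' hne.symm) (ψ ω) hω (not_le.1 hE)
end
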